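/- (Theorem 1.) Let (Ω, μ) be a probability space, d ≥ 1, N ≥ 1, and for each i ∈ {1,…,N} let X_i : Ω → ℝ^d be a random vector with integrable squared norm satisfying E[X_i] = v_i for fixed vectors v_i ∈ ℝ^d, and let w_i ∈ ℝ^d be fixed vectors. Define Y_pseudo = (1/N) ∑_{i=1}^N E[‖X_i − v_i‖²], Y_vanilla = (1/N) ∑_{i=1}^N ‖w_i − v_i‖², and for α ∈ ℝ define Y_comb(α) = (1/N) ∑_{i=1}^N E[‖α·X_i + (1 − α)·w_i − v_i‖²]. Assume Y_pseudo > 0 and Y_vanilla > 0. Then Y_comb attains its minimum over ℝ at α* = Y_vanilla/(Y_vanilla + Y_pseudo), the minimum value equals Y_vanilla · Y_pseudo / (Y_vanilla + Y_pseudo), and this minimum is strictly smaller than min(Y_vanilla, Y_pseudo). -/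

import Mathlib

open MeasureTheory

/-- Bias–variance decomposition of the mean squared error of the combination
`α • X + (1 - α) • w` of an unbiased estimator `X` of `v` with a fixed vector `w`. -/
theorem integral_norm_sq_combination_sub
    {Ω E : Type*} [MeasurableSpace Ω] {μ : Measure Ω} [IsProbabilityMeasure μ]
    [NormedAddCommGroup E] [InnerProductSpace ℝ E] [CompleteSpace E]
    {X : Ω → E} {v : E} (hX : MemLp X 2 μ) (hmean : ∫ ω, X ω ∂μ = v) (w : E) (α : ℝ) :
    ∫ ω, ‖α • X ω + (1 - α) • w - v‖ ^ 2 ∂μ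
      = α ^ 2 * ∫ ω, ‖X ω - v‖ ^ 2 ∂μ + (1 - α) ^ 2 * ‖w - v‖ ^ 2 := by
  have hcentered : MemLp (fun ω => X ω - v) 2 μ := hX.sub (memLp_const v)
  have hint : Integrable (fun ω => X ω - v) μ := hcentered.integrable one_le_two
  have hsq : Integrable (fun ω => ‖X ω - v‖ ^ 2) μ := hcentered.integrable_norm_pow two_ne_zero
  have hcross : ∫ ω, inner ℝ (w - v) (X ω - v) ∂μ = 0 := by
    rw [integral_inner hint, integral_sub (hX.integrable one_le_two) (integrable_const v), hmean]
    simp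
  have hexpand : ∀ ω, ‖α • X ω + (1 - α) • w - v‖ ^ 2
      = α ^ 2 * ‖X ω - v‖ ^ 2 + 2 * α * (1 - α) * inner ℝ (w - v) (X ω - v)
        + (1 - α) ^ 2 * ‖w - v‖ ^ 2 := by
    intro ω
    have hsplit : α • X ω + (1 - α) • w - v = α • (X ω - v) + (1 - α) • (w - v) := by
      module
    rw [hsplit, norm_add_sq_real, norm_smul, norm_smul, real_inner_smul_left,
      real_inner_smul_right, real_inner_comm, mul_pow, mul_pow, Real.norm_eq_abs,
      Real.norm_eq_abs, sq_abs, sq_abs]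
    ring
  have hinner : Integrable (fun ω => inner ℝ (w - v) (X ω - v)) μ := hint.const_inner (w - v)
  simp_rw [hexpand]
  rw [integral_add (by fun_prop) (integrable_const _),
    integral_add (hsq.const_mul _) (hinner.const_mul _), integral_const_mul,
    integral_const_mul, hcross]
  simp

/-- Theorem 1 of the paper: with pseudo labels `X i` (unbiased for the unknown true
labels `v i`, integrable squared norms) and vanilla labels `w i`, let
`Y_pseudo`, `Y_vanilla`, and `Y_comb(α)` be the averaged approximation errors of the
pseudo, vanilla, and combined labels `α·Xᵢ + (1 − α)·wᵢ`. If `Y_pseudo > 0` and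
`Y_vanilla > 0`, then `Y_comb` attains its minimum over `ℝ` at
`α* = Y_vanilla/(Y_vanilla + Y_pseudo)`, the minimum equals
`Y_vanilla·Y_pseudo/(Y_vanilla + Y_pseudo)`, and it is strictly smaller than
`min(Y_vanilla, Y_pseudo)`. -/
theorem assist_theorem_one
    {Ω : Type*} [MeasurableSpace Ω] (μ : Measure Ω) [IsProbabilityMeasure μ]
    (d : ℕ) (hd : 1 ≤ d) (N : ℕ) (hN : 1 ≤ N)
    (X : Fin N → Ω → EuclideanSpace ℝ (Fin d))
    (v w : Fin N → EuclideanSpace ℝ (Fin d))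
    (hXm : ∀ i, AEStronglyMeasurable (X i) μ)
    (hX2 : ∀ i, Integrable (fun ω => ‖X i ω‖ ^ 2) μ)
    (hunbiased : ∀ i, (∫ ω, X i ω ∂μ) = v i)
    (Ypseudo Yvanilla : ℝ) (Ycomb : ℝ → ℝ)
    (hYp : Ypseudo = (1 / (N : ℝ)) * ∑ i, ∫ ω, ‖X i ω - v i‖ ^ 2 ∂μ)
    (hYv : Yvanilla = (1 / (N : ℝ)) * ∑ i, ‖w i - v i‖ ^ 2)
    (hYc : ∀ α : ℝ, Ycomb α
      = (1 / (N : ℝ)) * ∑ i, ∫ ω, ‖α • X i ω + (1 - α) • w i - v i‖ ^ 2 ∂μ)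
    (hp : 0 < Ypseudo) (hv : 0 < Yvanilla) :
    (∀ α : ℝ, Ycomb (Yvanilla / (Yvanilla + Ypseudo)) ≤ Ycomb α) ∧
    Ycomb (Yvanilla / (Yvanilla + Ypseudo))
      = Yvanilla * Ypseudo / (Yvanilla + Ypseudo) ∧
    Yvanilla * Ypseudo / (Yvanilla + Ypseudo) < min Yvanilla Ypseudo := by
  have hcomb : ∀ α : ℝ, Ycomb α = α ^ 2 * Ypseudo + (1 - α) ^ 2 * Yvanilla := by
    intro α
    have hterm : ∀ i, ∫ ω, ‖α • X i ω + (1 - α) • w i - v i‖ ^ 2 ∂μ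
        = α ^ 2 * ∫ ω, ‖X i ω - v i‖ ^ 2 ∂μ + (1 - α) ^ 2 * ‖w i - v i‖ ^ 2 := fun i =>
      integral_norm_sq_combination_sub
        ((memLp_two_iff_integrable_sq_norm (hXm i)).2 (hX2 i)) (hunbiased i) (w i) α
    rw [hYc, hYp, hYv, Finset.sum_congr rfl fun i _ => hterm i, Finset.sum_add_distrib,
      ← Finset.mul_sum, ← Finset.mul_sum]
    ring
  have hsum : 0 < Yvanilla + Ypseudo := add_pos hv hp
  have hmin : Ycomb (Yvanilla / (Yvanilla + Ypseudo))
      = Yvanilla * Ypseudo / (Yvanilla + Ypseudo) := by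
    rw [hcomb]
    field_simp
    ring
  refine ⟨fun α => ?_, hmin, lt_min ?_ ?_⟩
  · rw [hmin, hcomb, div_le_iff₀ hsum]
    nlinarith [sq_nonneg (α * (Yvanilla + Ypseudo) - Yvanilla)]
  · rw [div_lt_iff₀ hsum]
    nlinarith [mul_pos hv hv]
  · rw [div_lt_iff₀ hsum]
    nlinarith [mul_pos hp hp]
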